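/- There exists an absolute constant c > 0 such that the following holds: for every totally real number field K of degree d ≥ 2 over ℚ with discriminant Δ_K, and all reals X, Y ≥ 2, there exists a finite set A ⊆ O_K such that (cXY)^d/(Y·Δ_K^{3/2}) ≤ |A| ≤ (XY/c)^d, |AA| ≤ c^{−d}·Y^{1−d}·Δ_K^{2}·|A|^2, and |A+A| ≤ (e^Y/c)^d·Δ_K^{1/2}·|A|. -/

import Mathlib

open Pointwise NumberField

/-- A number field is totally real if every embedding into `ℂ` takes real values. -/
def TotallyReal (K : Type*) [Field K] : Prop :=
  ∀ φ : K →+* ℂ, ∀ x : K, (φ x).im = 0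

open Finset in
/-- The number of functions `ι → ℕ` of sum `t`, by weighting each with `(3/4) ^ t`. -/
theorem card_piAntidiag_univ_le {ι : Type*} [Fintype ι] [DecidableEq ι] (t : ℕ) :
    (#(piAntidiag (univ : Finset ι) t) : ℝ) ≤ 4 ^ Fintype.card ι * (4 / 3) ^ t := by
  have hsub : piAntidiag (univ : Finset ι) t ⊆ Fintype.piFinset fun _ => range (t + 1) := by
    intro q hq
    rw [mem_piAntidiag] at hq
    rw [Fintype.mem_piFinset]
    intro i
    have := single_le_sum (f := q) (fun _ _ => Nat.zero_le _) (mem_univ i)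
    rw [hq.1] at this
    exact mem_range.2 (Nat.lt_succ_of_le this)
  have hgeom : ∑ j ∈ range (t + 1), (3 / 4 : ℝ) ^ j ≤ 4 := by
    rw [geom_sum_eq (by norm_num)]
    have : (0 : ℝ) < (3 / 4) ^ (t + 1) := by positivity
    rw [div_le_iff_of_neg (by norm_num)]
    linarith
  have hsum : ∑ q ∈ piAntidiag (univ : Finset ι) t, ∏ i, (3 / 4 : ℝ) ^ q i ≤
      4 ^ Fintype.card ι := by
    calc _ ≤ ∑ q ∈ Fintype.piFinset fun _ : ι => range (t + 1), ∏ i, (3 / 4 : ℝ) ^ q i :=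
          sum_le_sum_of_subset_of_nonneg hsub fun _ _ _ => by positivity
      _ = ∏ _i : ι, ∑ j ∈ range (t + 1), (3 / 4 : ℝ) ^ j :=
          (prod_univ_sum (fun _ : ι => range (t + 1)) fun _ j => (3 / 4 : ℝ) ^ j).symm
      _ ≤ _ := by
          rw [prod_const, card_univ]
          gcongr
  have hconst : ∀ q ∈ piAntidiag (univ : Finset ι) t, ∏ i, (3 / 4 : ℝ) ^ q i = (3 / 4) ^ t := by
    intro q hq
    rw [prod_pow_eq_pow_sum, (mem_piAntidiag.1 hq).1]
  rw [sum_congr rfl hconst, sum_const, nsmul_eq_mul] at hsum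
  have h1 : (3 / 4 : ℝ) ^ t * (4 / 3) ^ t = 1 := by rw [← mul_pow]; norm_num
  calc _ = (#(piAntidiag (univ : Finset ι) t) : ℝ) * (3 / 4) ^ t * (4 / 3) ^ t := by
        rw [mul_assoc, h1, mul_one]
    _ ≤ _ := by gcongr

open Finset in
theorem card_piAntidiag_univ_eq_choose {ι : Type*} [Fintype ι] [DecidableEq ι] [Nonempty ι]
    (n : ℕ) : #(piAntidiag (univ : Finset ι) n) =
      (n + (Fintype.card ι - 1)).choose (Fintype.card ι - 1) := by
  have hpos := Fintype.card_pos (α := ι)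
  rw [← map_sym_eq_piAntidiag, card_map, sym_univ, card_univ, Sym.card_sym_eq_choose,
    ← Nat.choose_symm_add]
  congr 1
  omega

open Finset in
theorem pow_le_card_piAntidiag_univ {ι : Type*} [Fintype ι] [DecidableEq ι] [Nonempty ι]
    (y : ℕ) : y ^ (Fintype.card ι - 1) ≤ #(piAntidiag (univ : Finset ι) (y * Fintype.card ι)) := by
  rw [card_piAntidiag_univ_eq_choose]
  obtain ⟨k, hk⟩ := Nat.exists_eq_add_one.2 (Fintype.card_pos (α := ι))
  rw [hk, Nat.add_sub_cancel]
  have h1 := Nat.pow_sub_le_descFactorial (y * (k + 1) + k) k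
  rw [Nat.descFactorial_eq_factorial_mul_choose] at h1
  have h2 : (k + 1) ^ k * y ^ k ≤ (y * (k + 1) + k + 1 - k) ^ k := by
    rw [← mul_pow]
    gcongr
    rw [mul_comm]; omega
  have h3 : k.factorial ≤ (k + 1) ^ k :=
    (Nat.factorial_le_pow k).trans (Nat.pow_le_pow_left (Nat.le_succ k) k)
  refine Nat.le_of_mul_le_mul_left ?_ k.factorial_pos
  exact (Nat.mul_le_mul_right _ h3).trans (h2.trans h1)

open Finset in
theorem card_piAntidiag_univ_two_mul_le {ι : Type*} [Fintype ι] [DecidableEq ι] [Nonempty ι]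
    {y : ℕ} (hy : 1 ≤ y) :
    (#(piAntidiag (univ : Finset ι) (y * Fintype.card ι + y * Fintype.card ι)) : ℝ) ≤
      9 ^ Fintype.card ι * y ^ (Fintype.card ι - 1) := by
  rw [card_piAntidiag_univ_eq_choose]
  obtain ⟨k, hk⟩ := Nat.exists_eq_add_one.2 (Fintype.card_pos (α := ι))
  rw [hk, Nat.add_sub_cancel]
  set n := y * (k + 1) + y * (k + 1) + k
  have hn : n ≤ 3 * y * (k + 1) := by
    have : 1 * (k + 1) ≤ y * (k + 1) := Nat.mul_le_mul_right _ hy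
    have e : 3 * y * (k + 1) = 3 * (y * (k + 1)) := by ring
    omega
  have hexp : ((k : ℝ) + 1) ^ k / k.factorial ≤ 3 ^ (k + 1) := by
    have h := Real.pow_div_factorial_le_exp (x := (k : ℝ) + 1) (by positivity) k
    refine h.trans ?_
    have : Real.exp ((k : ℝ) + 1) = Real.exp 1 ^ (k + 1) := by
      rw [← Real.exp_nat_mul]; push_cast; ring_nf
    rw [this]
    gcongr
    exact Real.exp_one_lt_three.le
  calc ((n.choose k : ℕ) : ℝ) ≤ (n : ℝ) ^ k / k.factorial := Nat.choose_le_pow_div k n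
    _ ≤ (3 * y * (k + 1)) ^ k / k.factorial := by
        gcongr
        exact_mod_cast hn
    _ = 3 ^ k * y ^ k * (((k : ℝ) + 1) ^ k / k.factorial) := by rw [mul_pow, mul_pow]; ring
    _ ≤ 3 ^ (k + 1) * y ^ k * 3 ^ (k + 1) := by
        gcongr
        · norm_num
        · omega
    _ = 9 ^ (k + 1) * y ^ k := by
        rw [show (9 : ℝ) = 3 * 3 by norm_num, mul_pow]; ring

open Finset in
theorem card_le_of_le_of_sum_eq {ι : Type*} [Fintype ι] [DecidableEq ι] {n t : ℕ} {M : ι → ℕ}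
    {D : Finset (ι → ℕ)} (hD : ∀ m ∈ D, m ≤ M ∧ ∑ i, m i = n) (hM : ∑ i, M i ≤ n + t) :
    (#D : ℝ) ≤ 4 ^ Fintype.card ι * (4 / 3) ^ t := by
  have hcard : #D ≤ #(piAntidiag (univ : Finset ι) (∑ i, M i - n)) := by
    refine card_le_card_of_injOn (fun m => M - m) ?_ ?_
    · intro m hm
      obtain ⟨h1, h2⟩ := hD m hm
      rw [mem_coe, mem_piAntidiag]
      refine ⟨?_, fun _ _ => mem_univ _⟩
      have : ∑ i, (M - m) i + ∑ i, m i = ∑ i, M i := by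
        rw [← sum_add_distrib]
        exact sum_congr rfl fun i _ => Nat.sub_add_cancel (h1 i)
      exact Nat.eq_sub_of_add_eq (h2 ▸ this)
    · intro m hm m' hm' h
      ext i
      have h1 : m i ≤ M i := (hD m hm).1 i
      have h2 : m' i ≤ M i := (hD m' hm').1 i
      have h3 : M i - m i = M i - m' i := congrFun h i
      omega
  calc (#D : ℝ) ≤ #(piAntidiag (univ : Finset ι) (∑ i, M i - n)) := mod_cast hcard
    _ ≤ 4 ^ Fintype.card ι * (4 / 3) ^ (∑ i, M i - n) := card_piAntidiag_univ_le _
    _ ≤ _ := by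
        gcongr
        · norm_num
        · omega

/-- Below any function of sum at least `t` there is one of sum exactly `t`. -/
theorem exists_le_sum_eq {ι : Type*} [Fintype ι] {t : ℕ} {f : ι → ℕ} (h : t ≤ ∑ i, f i) :
    ∃ q ≤ f, ∑ i, q i = t := by
  classical
  induction t with
  | zero => exact ⟨0, fun i => Nat.zero_le _, by simp⟩
  | succ t ih =>
    obtain ⟨q, hq, hs⟩ := ih (by omega)
    obtain ⟨i, -, hi⟩ := Finset.exists_lt_of_sum_lt (s := Finset.univ) (f := q) (g := f) (by omega)
    refine ⟨q + Pi.single i 1, fun j => ?_, ?_⟩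
    · by_cases hj : j = i
      · subst hj; simpa using hi
      · simpa [hj] using hq j
    · simp [Finset.sum_add_distrib, hs]

namespace NumberField

open InfinitePlace

/-- The algebraic integers `x` with `|x|_w ≤ f w` at every infinite place `w`. -/
def integerBox (K : Type*) [Field K] (f : InfinitePlace K → ℝ) : Set (𝓞 K) :=
  {x | ∀ w : InfinitePlace K, w (x : K) ≤ f w}

variable {K : Type*} [Field K] {f g : InfinitePlace K → ℝ} {x y : 𝓞 K}

theorem integerBox_mono (h : f ≤ g) : integerBox K f ⊆ integerBox K g :=
  fun _ hx w => (hx w).trans (h w)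

theorem add_mem_integerBox (hx : x ∈ integerBox K f) (hy : y ∈ integerBox K g) :
    x + y ∈ integerBox K (f + g) := fun w => by
  exact (w.1.add_le _ _).trans (add_le_add (hx w) (hy w))

theorem mul_mem_integerBox (hx : x ∈ integerBox K f) (hy : y ∈ integerBox K g) :
    x * y ∈ integerBox K (f * g) := fun w => by
  change w ((x : K) * (y : K)) ≤ f w * g w
  rw [map_mul]
  exact mul_le_mul (hx w) (hy w) (apply_nonneg _ _) ((apply_nonneg _ _).trans (hx w))

variable [NumberField K] [IsTotallyReal K]

theorem card_infinitePlace_of_isTotallyReal :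
    Fintype.card (InfinitePlace K) = Module.finrank ℚ K := by
  rw [IsTotallyReal.finrank, card_eq_nrRealPlaces_add_nrComplexPlaces,
    IsTotallyReal.nrComplexPlaces_eq_zero, add_zero]

theorem one_le_prod_apply_of_isTotallyReal (hx : x ≠ 0) :
    1 ≤ ∏ w : InfinitePlace K, w (x : K) := by
  have h := prod_eq_abs_norm (x : K)
  simp only [IsTotallyReal.mult_eq, pow_one] at h
  rw [h, ← Algebra.coe_norm_int]
  have : Algebra.norm ℤ x ≠ 0 := Algebra.norm_ne_zero_iff.2 hx
  exact_mod_cast Int.one_le_abs this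

theorem integerBox_subset_singleton (hf : ∏ w, f w < 1) : integerBox K f ⊆ {0} := by
  intro x hx
  by_contra h
  have h1 := one_le_prod_apply_of_isTotallyReal h
  have h2 : ∏ w : InfinitePlace K, w (x : K) ≤ ∏ w, f w :=
    Finset.prod_le_prod (fun w _ => apply_nonneg w _) fun w _ => hx w
  linarith

theorem re_embedding_sub_of_isTotallyReal (w : InfinitePlace K) (x y : K) :
    |(w.embedding x).re - (w.embedding y).re| = w (x - y) := by
  rw [← norm_embedding_eq, ← Complex.sub_re, ← map_sub]
  have : (w.embedding (x - y)).im = 0 :=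
    Complex.conj_eq_iff_im.1 (DFunLike.congr_fun
      (IsTotallyReal.complexEmbedding_isReal w.embedding).star_eq (x - y))
  exact (Complex.abs_re_eq_norm.2 this)

theorem integerBox_finite_and_ncard_le (hf : ∀ w, 0 < f w) (h1 : 1 ≤ ∏ w, f w) :
    (integerBox K f).Finite ∧
      ((integerBox K f).ncard : ℝ) ≤ 4 ^ Module.finrank ℚ K * ∏ w, f w := by
  classical
  set d := Module.finrank ℚ K
  have hd : d ≠ 0 := Module.finrank_pos.ne'
  set R : ℝ := (∏ w, f w) ^ (d⁻¹ : ℝ)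
  have hRd : R ^ d = ∏ w, f w := Real.rpow_inv_natCast_pow (by positivity) hd
  have hR : 1 ≤ R := Real.one_le_rpow h1 (by positivity)
  set φ : 𝓞 K → InfinitePlace K → ℤ := fun x w => ⌊(w.embedding (x : K)).re * (R / f w)⌋
  set I : Finset ℤ := Finset.Icc ⌊-R⌋ ⌊R⌋
  set T : Finset (InfinitePlace K → ℤ) := Fintype.piFinset fun _ => I
  have hI : (I.card : ℝ) ≤ 4 * R := by
    have h2 : ⌊-R⌋ ≤ ⌊R⌋ + 1 := (Int.floor_mono (by linarith)).trans (lt_add_one _).le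
    have h3 : ((I.card : ℤ) : ℝ) = ⌊R⌋ + 1 - ⌊-R⌋ := by
      rw [Int.card_Icc_of_le _ _ h2]; push_cast; rfl
    rw [Int.cast_natCast] at h3
    rw [h3]
    linarith [Int.floor_le R, Int.lt_floor_add_one (-R)]
  have hT : (T.card : ℝ) ≤ 4 ^ d * ∏ w, f w := by
    rw [Fintype.card_piFinset, Finset.prod_const, Finset.card_univ,
      card_infinitePlace_of_isTotallyReal, ← hRd, ← mul_pow]
    push_cast
    gcongr
  have hmaps : Set.MapsTo φ (integerBox K f) T := by
    intro x hx
    rw [Finset.mem_coe, Fintype.mem_piFinset]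
    intro w
    have hw : |(w.embedding (x : K)).re| ≤ f w :=
      (Complex.abs_re_le_norm _).trans (by rw [norm_embedding_eq]; exact hx w)
    have : |(w.embedding (x : K)).re * (R / f w)| ≤ R := by
      rw [abs_mul, abs_of_pos (div_pos (by linarith) (hf w)), ← mul_div_assoc,
        div_le_iff₀ (hf w), mul_comm]
      gcongr
    rw [abs_le] at this
    exact Finset.mem_Icc.2 ⟨Int.floor_mono this.1, Int.floor_mono this.2⟩
  have hinj : Set.InjOn φ (integerBox K f) := by
    intro x _ y _ h
    by_contra hne
    have hlt : ∀ w : InfinitePlace K, w ((x - y : 𝓞 K) : K) < f w / R := by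
      intro w
      have := Int.abs_sub_lt_one_of_floor_eq_floor (congrFun h w)
      rw [← sub_mul, abs_mul, abs_of_pos (div_pos (by linarith) (hf w)),
        re_embedding_sub_of_isTotallyReal, ← mul_div_assoc, div_lt_one (hf w)] at this
      rw [lt_div_iff₀ (by linarith)]
      exact this
    have hsub : x - y ≠ 0 := sub_ne_zero.2 hne
    have h2 : ∏ w : InfinitePlace K, w ((x - y : 𝓞 K) : K) < ∏ w, f w / R :=
      Finset.prod_lt_prod_of_nonempty
        (fun w _ => pos_iff.2 (RingOfIntegers.coe_ne_zero_iff.2 hsub)) (fun w _ => hlt w)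
        Finset.univ_nonempty
    rw [Finset.prod_div_distrib, Finset.prod_const, Finset.card_univ,
      card_infinitePlace_of_isTotallyReal, hRd, div_self (by linarith)] at h2
    exact absurd (one_le_prod_apply_of_isTotallyReal hsub) h2.not_ge
  refine ⟨Set.Finite.of_injOn hmaps hinj T.finite_toSet, le_trans ?_ hT⟩
  rw [← Set.ncard_coe_finset T]
  exact_mod_cast Set.ncard_le_ncard_of_injOn φ hmaps hinj T.finite_toSet

theorem integerBox_finite (hf : ∀ w, 0 < f w) : (integerBox K f).Finite := by
  rcases lt_or_ge (∏ w, f w) 1 with h | h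
  · exact (Set.finite_singleton 0).subset (integerBox_subset_singleton h)
  · exact (integerBox_finite_and_ncard_le hf h).1

theorem ncard_integerBox_sdiff_le (hf : ∀ w, 0 < f w) :
    ((integerBox K f \ {0}).ncard : ℝ) ≤ 4 ^ Module.finrank ℚ K * ∏ w, f w := by
  rcases lt_or_ge (∏ w, f w) 1 with h | h
  · rw [Set.sdiff_eq_empty.2 (integerBox_subset_singleton h), Set.ncard_empty]
    have : 0 < ∏ w, f w := Finset.prod_pos fun w _ => hf w
    simp only [CharP.cast_eq_zero]
    positivity
  · refine le_trans ?_ (integerBox_finite_and_ncard_le hf h).2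
    exact_mod_cast Set.ncard_le_ncard Set.sdiff_subset (integerBox_finite hf)

end NumberField

open MeasureTheory in
/-- A counting form of **Blichfeldt's theorem**. -/
theorem MeasureTheory.IsAddFundamentalDomain.measure_le_mul_of_encard_le {E L : Type*}
    [MeasurableSpace E] {μ : Measure E} {F s : Set E} [AddGroup L] [Countable L] [AddAction L E]
    [MeasurableSpace L] [MeasurableVAdd L E] [VAddInvariantMeasure L E μ]
    (fund : IsAddFundamentalDomain L F μ) (hs : MeasurableSet s) (k : ℕ)
    (h : ∀ u, {g : L | u ∈ g +ᵥ s}.encard ≤ k) : μ s ≤ k * μ F := by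
  calc μ s = ∑' g : L, μ ((g +ᵥ s) ∩ F) := fund.measure_eq_tsum s
    _ = ∑' g : L, ∫⁻ u in F, (g +ᵥ s).indicator 1 u ∂μ := by
        congr with g
        rw [lintegral_indicator_one (hs.const_vadd g), Measure.restrict_apply (hs.const_vadd g)]
    _ = ∫⁻ u in F, ∑' g : L, (g +ᵥ s).indicator 1 u ∂μ :=
        (lintegral_tsum fun g =>
          (measurable_one.indicator (hs.const_vadd g)).aemeasurable).symm
    _ ≤ ∫⁻ _ in F, k ∂μ := by
        refine lintegral_mono fun u => ?_
        have : ∑' g : L, (g +ᵥ s).indicator (1 : E → ENNReal) u =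
            ∑' g : {g : L | u ∈ g +ᵥ s}, (1 : ENNReal) := by
          rw [tsum_subtype {g : L | u ∈ g +ᵥ s} (fun _ => (1 : ENNReal))]
          rfl
        rw [this, ENNReal.tsum_set_one]
        exact (ENat.toENNReal_le.2 (h u)).trans_eq (ENat.toENNReal_coe k)
    _ = k * μ F := by rw [setLIntegral_const]

namespace NumberField

open InfinitePlace mixedEmbedding MeasureTheory

variable {K : Type*} [Field K] {f : InfinitePlace K → ℝ} [NumberField K] [IsTotallyReal K]

theorem prod_le_ncard_integerBox_mul_sqrt_discr (hf : ∀ w, 0 < f w) :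
    ∏ w, f w ≤ (integerBox K f).ncard * √(|discr K| : ℤ) := by
  classical
  set g : InfinitePlace K → NNReal := fun w => (f w / 2).toNNReal
  have hg : ∀ w, (g w : ℝ) = f w / 2 := fun w => Real.coe_toNNReal _ (by linarith [hf w])
  set L := (Submodule.span ℤ (Set.range (latticeBasis K))).toAddSubgroup
  have : Countable L := inferInstanceAs (Countable (Submodule.span ℤ (Set.range (latticeBasis K))))
  have hfund : IsAddFundamentalDomain L _ volume :=
    ZSpan.isAddFundamentalDomain' (latticeBasis K) volume
  have hmeas : MeasurableSet (convexBodyLT K g) :=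
    (MeasurableSet.univ_pi fun _ => measurableSet_ball).prod
      (MeasurableSet.univ_pi fun _ => measurableSet_ball)
  have hψ : ∀ v : L, ∃ x : 𝓞 K, mixedEmbedding K x = v := by
    rintro ⟨v, hv⟩
    rw [Submodule.mem_toAddSubgroup, mem_span_latticeBasis] at hv
    obtain ⟨x, hx⟩ := hv
    exact ⟨x, hx⟩
  choose ψ hψ using hψ
  have hcount : ∀ u, {v : L | u ∈ v +ᵥ convexBodyLT K g}.encard ≤ (integerBox K f).ncard := by
    intro u
    rcases Set.eq_empty_or_nonempty {v : L | u ∈ v +ᵥ convexBodyLT K g} with he | ⟨v₀, hv₀⟩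
    · rw [he, Set.encard_empty]; exact zero_le
    rw [(integerBox_finite hf).cast_ncard_eq]
    refine Set.encard_le_encard_of_injOn (f := fun v => ψ v - ψ v₀) ?_ ?_
    · intro v hv w
      obtain ⟨s₀, hs₀, h₀⟩ := hv₀
      obtain ⟨s, hs, h⟩ := hv
      have hsub : mixedEmbedding K ((ψ v - ψ v₀ : 𝓞 K) : K) = s₀ - s := by
        have h' : (v : mixedSpace K) + s = v₀ + s₀ := h.trans h₀.symm
        rw [RingOfIntegers.coe_eq_algebraMap, map_sub, map_sub, hψ, hψ, sub_eq_sub_iff_add_eq_add, h',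
          add_comm]
      have hmem : mixedEmbedding K ((ψ v - ψ v₀ : 𝓞 K) : K) ∈ convexBodyLT K (g + g) := by
        rw [hsub]
        have hcoe : ∀ w, ((g + g) w : ℝ) = g w + g w := fun w => by simp
        simp only [Set.mem_prod, Set.mem_pi, Set.mem_univ, forall_true_left,
          mem_ball_zero_iff] at hs hs₀ ⊢
        exact ⟨fun w => (norm_sub_le _ _).trans_lt (hcoe w ▸ add_lt_add (hs₀.1 w) (hs.1 w)),
          fun w => (norm_sub_le _ _).trans_lt (hcoe w ▸ add_lt_add (hs₀.2 w) (hs.2 w))⟩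
      have := (convexBodyLT_mem K (g + g)).1 hmem w
      rw [Pi.add_apply, NNReal.coe_add, hg, add_halves] at this
      exact this.le
    · intro v _ v' _ h
      have : ψ v = ψ v' := sub_left_injective h
      rw [Subtype.ext_iff, ← hψ, ← hψ, this]
  have key := hfund.measure_le_mul_of_encard_le hmeas _ hcount
  rw [convexBodyLT_volume, volume_fundamentalDomain_latticeBasis,
    IsTotallyReal.nrComplexPlaces_eq_zero, pow_zero, one_mul] at key
  simp only [IsTotallyReal.mult_eq, pow_one, convexBodyLTFactor,
    IsTotallyReal.nrComplexPlaces_eq_zero, pow_zero, mul_one] at key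
  have key' : (2 : NNReal) ^ nrRealPlaces K * ∏ w, g w ≤
      (integerBox K f).ncard * NNReal.sqrt ‖discr K‖₊ := by exact_mod_cast key
  have key'' : (2 : ℝ) ^ nrRealPlaces K * ∏ w, (g w : ℝ) ≤
      (integerBox K f).ncard * √‖discr K‖ := by
    simpa using NNReal.coe_le_coe.2 key'
  rw [← IsTotallyReal.finrank, ← card_infinitePlace_of_isTotallyReal, ← Finset.card_univ,
    ← Finset.prod_const, ← Finset.prod_mul_distrib] at key''
  simp only [hg, mul_div_cancel₀ (f _) (two_ne_zero)] at key''
  rw [Int.norm_eq_abs] at key''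
  exact_mod_cast key''

end NumberField

namespace NumberField

open InfinitePlace Finset

section Dyadic

variable (K : Type*) [Field K]

/-- The algebraic integers in a box of side `H` shrunk by the factor `2 ^ m w` at each place. -/
def dyadicBox (H : ℝ) (m : InfinitePlace K → ℕ) : Set (𝓞 K) :=
  integerBox K fun w => H / 2 ^ m w

variable {K} {H : ℝ} {m q : InfinitePlace K → ℕ} {n t : ℕ}

theorem dyadicBox_anti (hH : 0 < H) (h : m ≤ q) : dyadicBox K H q ⊆ dyadicBox K H m :=
  integerBox_mono fun w => by
    have : m w ≤ q w := h w
    dsimp only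
    gcongr
    norm_num

variable [NumberField K]

open Classical in
/-- The union of the dyadic boxes of side `H` shrunk by the factor `2 ^ n` in volume. It
approximates the hyperbolic region cut out of a cube by a bound on the norm. -/
def dyadicUnion (K : Type*) [Field K] [NumberField K] (H : ℝ) (n : ℕ) : Set (𝓞 K) :=
  ⋃ m ∈ piAntidiag (univ : Finset (InfinitePlace K)) n, dyadicBox K H m

/-- The points of `dyadicBox K H m` lying in a box smaller by the factor `2 ^ t` in volume. -/
def thinPart (H : ℝ) (m : InfinitePlace K → ℕ) (t : ℕ) : Set (𝓞 K) :=
  {x | ∃ q : InfinitePlace K → ℕ, ∑ w, q w = t ∧ x ∈ dyadicBox K H (m + q)}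

theorem dyadicBox_subset_dyadicUnion (h : ∑ w, m w = n) :
    dyadicBox K H m ⊆ dyadicUnion K H n := by
  classical
  exact Set.subset_biUnion_of_mem (u := fun m => dyadicBox K H m)
    (mem_piAntidiag.2 ⟨h, fun _ _ => mem_univ _⟩)

theorem mem_dyadicUnion {x : 𝓞 K} :
    x ∈ dyadicUnion K H n ↔ ∃ m : InfinitePlace K → ℕ, ∑ w, m w = n ∧ x ∈ dyadicBox K H m := by
  simp [dyadicUnion]

theorem dyadicUnion_mul_subset :
    dyadicUnion K H n * dyadicUnion K H n ⊆ dyadicUnion K (H * H) (n + n) := by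
  rintro _ ⟨x, hx, y, hy, rfl⟩
  obtain ⟨m, hm, hx⟩ := mem_dyadicUnion.1 hx
  obtain ⟨q, hq, hy⟩ := mem_dyadicUnion.1 hy
  refine mem_dyadicUnion.2 ⟨m + q, by simp [sum_add_distrib, hm, hq], ?_⟩
  refine integerBox_mono (fun w => le_of_eq ?_) (mul_mem_integerBox hx hy)
  simp only [Pi.mul_apply, Pi.add_apply, pow_add]
  rw [div_mul_div_comm]

theorem dyadicUnion_subset_integerBox (hH : 0 < H) :
    dyadicUnion K H n ⊆ integerBox K fun _ => H := by
  intro x hx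
  obtain ⟨m, -, hx⟩ := mem_dyadicUnion.1 hx
  exact fun w => (hx w).trans (div_le_self hH.le (one_le_pow₀ one_le_two))

variable [IsTotallyReal K]

theorem prod_div_two_pow (H : ℝ) (m : InfinitePlace K → ℕ) :
    ∏ w, H / 2 ^ m w = H ^ Module.finrank ℚ K / 2 ^ ∑ w, m w := by
  rw [prod_div_distrib, prod_const, card_univ, card_infinitePlace_of_isTotallyReal,
    prod_pow_eq_pow_sum]

theorem dyadicBox_finite (hH : 0 < H) : (dyadicBox K H m).Finite :=
  integerBox_finite fun _ => by positivity

theorem dyadicUnion_finite (hH : 0 < H) : (dyadicUnion K H n).Finite :=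
  (integerBox_finite fun _ => hH).subset (dyadicUnion_subset_integerBox hH)

theorem ncard_dyadicUnion_le [DecidableEq (InfinitePlace K)] (hH : 0 < H)
    (h : 1 ≤ H ^ Module.finrank ℚ K / 2 ^ n) :
    ((dyadicUnion K H n).ncard : ℝ) ≤ #(piAntidiag (univ : Finset (InfinitePlace K)) n) *
      (4 ^ Module.finrank ℚ K * (H ^ Module.finrank ℚ K / 2 ^ n)) := by
  have hunion : dyadicUnion K H n =
      ⋃ m ∈ piAntidiag (univ : Finset (InfinitePlace K)) n, dyadicBox K H m := by
    ext x; simp [mem_dyadicUnion]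
  rw [hunion, ← nsmul_eq_mul]
  refine le_trans (b := ∑ m ∈ piAntidiag (univ : Finset (InfinitePlace K)) n,
    ((dyadicBox K H m).ncard : ℝ)) (mod_cast set_ncard_biUnion_le _ _) ?_
  refine sum_le_card_nsmul _ _ _ fun m hm => ?_
  have hp := prod_div_two_pow H m
  rw [(mem_piAntidiag.1 hm).1] at hp
  rw [← hp] at h ⊢
  exact (integerBox_finite_and_ncard_le (fun _ => by positivity) h).2

theorem ncard_thinPart_sdiff_le (hH : 0 < H) (hm : ∑ w, m w = n) :
    ((thinPart H m t \ {0}).ncard : ℝ) ≤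
      16 ^ Module.finrank ℚ K * (2 / 3) ^ t * (H ^ Module.finrank ℚ K / 2 ^ n) := by
  classical
  set d := Module.finrank ℚ K
  have hunion : thinPart H m t \ {0} = ⋃ q ∈ piAntidiag (univ : Finset (InfinitePlace K)) t,
      dyadicBox K H (m + q) \ {0} := by
    ext x; simp [thinPart]; tauto
  calc ((thinPart H m t \ {0}).ncard : ℝ)
      ≤ ∑ q ∈ piAntidiag (univ : Finset (InfinitePlace K)) t,
          ((dyadicBox K H (m + q) \ {0}).ncard : ℝ) := by
        rw [hunion]; exact_mod_cast set_ncard_biUnion_le _ _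
    _ ≤ #(piAntidiag (univ : Finset (InfinitePlace K)) t) • (4 ^ d * (H ^ d / 2 ^ (n + t))) := by
        refine sum_le_card_nsmul _ _ _ fun q hq => ?_
        have hp := prod_div_two_pow H (m + q)
        simp only [Pi.add_apply, sum_add_distrib, hm, (mem_piAntidiag.1 hq).1] at hp
        rw [← hp]
        exact ncard_integerBox_sdiff_le fun _ => by positivity
    _ ≤ (4 ^ d * (4 / 3) ^ t) * (4 ^ d * (H ^ d / 2 ^ (n + t))) := by
        rw [nsmul_eq_mul]
        gcongr
        simpa [card_infinitePlace_of_isTotallyReal] using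
          card_piAntidiag_univ_le (ι := InfinitePlace K) t
    _ = _ := by
        rw [show (16 : ℝ) = 4 * 4 by norm_num, show (4 / 3 : ℝ) = 2 / 3 * 2 by norm_num, mul_pow,
          mul_pow, pow_add]
        field_simp

theorem card_thick_indices_le (hH : 0 < H) (x : 𝓞 K) {D : Finset (InfinitePlace K → ℕ)}
    (hD : ∀ m ∈ D, ∑ w, m w = n ∧ x ∈ dyadicBox K H m ∧ x ∉ thinPart H m t) :
    (#D : ℝ) ≤ 4 ^ Module.finrank ℚ K * (4 / 3) ^ t := by
  classical
  rcases D.eq_empty_or_nonempty with rfl | hne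
  · simp only [card_empty, CharP.cast_eq_zero]; positivity
  rw [← card_infinitePlace_of_isTotallyReal]
  refine card_le_of_le_of_sum_eq (n := n) (M := D.sup id)
    (fun m hm => ⟨le_sup (f := id) hm, (hD m hm).1⟩) ?_
  by_contra! hlt
  obtain ⟨m, hm⟩ := hne
  have hle : m ≤ D.sup id := le_sup (f := id) hm
  obtain ⟨hsum, -, hthin⟩ := hD m hm
  have hadd : ∑ w, (D.sup id - m) w + ∑ w, m w = ∑ w, D.sup id w := by
    rw [← sum_add_distrib]
    exact sum_congr rfl fun w _ => Nat.sub_add_cancel (hle w)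
  obtain ⟨q, hq, hqt⟩ := exists_le_sum_eq (t := t) (f := D.sup id - m) (by omega)
  refine hthin ⟨q, hqt, dyadicBox_anti hH (q := D.sup id) (fun w => ?_) fun w => ?_⟩
  · have h1 : q w ≤ (D.sup id) w - m w := hq w
    have h2 : m w ≤ (D.sup id) w := hle w
    change m w + q w ≤ (D.sup id) w
    omega
  · obtain ⟨m', hm', h'⟩ := exists_mem_eq_sup D ⟨m, hm⟩ (fun m => m w)
    change w (x : K) ≤ H / 2 ^ D.sup id w
    rw [Finset.sup_apply]
    simp only [id_eq]
    rw [h']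
    exact (hD m' hm').2.1 w

theorem card_mul_le_ncard_dyadicUnion [DecidableEq (InfinitePlace K)] (hH : 0 < H) {Δ : ℝ}
    (hΔ : Δ = √(|discr K| : ℤ)) (hV : 4 * Δ ≤ H ^ Module.finrank ℚ K / 2 ^ n) :
    #(piAntidiag (univ : Finset (InfinitePlace K)) n) * (H ^ Module.finrank ℚ K / 2 ^ n) ≤
      12 * 64 ^ Module.finrank ℚ K * Δ ^ 2 * (dyadicUnion K H n).ncard := by
  classical
  set d := Module.finrank ℚ K
  set V := H ^ d / 2 ^ n
  set P := piAntidiag (univ : Finset (InfinitePlace K)) n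
  have hΔ1 : 1 ≤ Δ := by
    rw [hΔ, Real.one_le_sqrt]
    exact_mod_cast Int.one_le_abs (discr_ne_zero K)
  obtain ⟨s, hs, hs'⟩ := exists_nat_pow_near (x := 4 * 16 ^ d * Δ) (y := 3 / 2)
    (by nlinarith [one_le_pow₀ (n := d) (show (1 : ℝ) ≤ 16 by norm_num)]) (by norm_num)
  set t := s + 1
  set A := (dyadicUnion_finite (K := K) (n := n) hH).toFinset
  set r : (InfinitePlace K → ℕ) → 𝓞 K → Prop := fun m x => x ∈ dyadicBox K H m \ thinPart H m t
  have hthick : ∀ m ∈ P, V / (2 * Δ) ≤ #(A.bipartiteAbove r m) := by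
    intro m hm
    have hmn := (mem_piAntidiag.1 hm).1
    have h1 : V ≤ (dyadicBox K H m).ncard * Δ := by
      have := prod_le_ncard_integerBox_mul_sqrt_discr (K := K) (f := fun w => H / 2 ^ m w)
        fun _ => by positivity
      rwa [prod_div_two_pow, hmn, ← hΔ] at this
    have h2 : dyadicBox K H m ⊆
        insert 0 ((A.bipartiteAbove r m : Set (𝓞 K)) ∪ thinPart H m t \ {0}) := by
      intro x hx
      have hxA : x ∈ A := by
        simpa [A] using dyadicBox_subset_dyadicUnion hmn hx
      by_cases h0 : x = 0
      · exact Or.inl h0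
      · by_cases ht : x ∈ thinPart H m t
        · exact Or.inr (Or.inr ⟨ht, h0⟩)
        · exact Or.inr (Or.inl (mem_coe.2 ((mem_bipartiteAbove r).2 ⟨hxA, hx, ht⟩)))
    have hthinfin : (thinPart H m t \ {0}).Finite := by
      refine (dyadicBox_finite (m := m) hH).subset ?_
      rintro x ⟨⟨q, -, hx⟩, -⟩
      exact dyadicBox_anti hH le_self_add hx
    have h3 : ((dyadicBox K H m).ncard : ℝ) ≤
        #(A.bipartiteAbove r m) + (thinPart H m t \ {0}).ncard + 1 := by
      have h4 := Set.ncard_le_ncard h2 (((finite_toSet _).union hthinfin).insert 0)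
      have h5 := Set.ncard_insert_le (0 : 𝓞 K)
        ((A.bipartiteAbove r m : Set (𝓞 K)) ∪ thinPart H m t \ {0})
      have h6 := Set.ncard_union_le (A.bipartiteAbove r m : Set (𝓞 K)) (thinPart H m t \ {0})
      rw [Set.ncard_coe_finset] at h6
      exact_mod_cast (by omega : (dyadicBox K H m).ncard ≤
        #(A.bipartiteAbove r m) + (thinPart H m t \ {0}).ncard + 1)
    have h7 : ((thinPart H m t \ {0}).ncard : ℝ) * (4 * Δ) ≤ V := by
      have hVpos : 0 < V := by linarith
      calc _ ≤ 16 ^ d * (2 / 3) ^ t * V * (4 * Δ) := by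
            gcongr
            exact ncard_thinPart_sdiff_le hH hmn
        _ = (4 * 16 ^ d * Δ) * (2 / 3) ^ t * V := by ring
        _ ≤ (3 / 2) ^ t * (2 / 3) ^ t * V := by gcongr
        _ = V := by rw [← mul_pow]; norm_num
    rw [div_le_iff₀ (by positivity)]
    nlinarith
  have hmult : ∀ x ∈ A, (#(P.bipartiteBelow r x) : ℝ) ≤ 4 ^ d * (4 / 3) ^ t := by
    intro x _
    refine card_thick_indices_le (n := n) hH x fun m hm => ?_
    obtain ⟨h1, h2, h3⟩ := (mem_bipartiteBelow r).1 hm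
    exact ⟨(mem_piAntidiag.1 h1).1, h2, h3⟩
  have hdouble : #P * (V / (2 * Δ)) ≤ #A * (4 ^ d * (4 / 3) ^ t) := by
    rw [← nsmul_eq_mul, ← nsmul_eq_mul]
    calc _ ≤ ∑ m ∈ P, (#(A.bipartiteAbove r m) : ℝ) := card_nsmul_le_sum _ _ _ hthick
      _ = ∑ x ∈ A, (#(P.bipartiteBelow r x) : ℝ) :=
          mod_cast sum_card_bipartiteAbove_eq_sum_card_bipartiteBelow r
      _ ≤ _ := sum_le_card_nsmul _ _ _ hmult
  have hA : (dyadicUnion K H n).ncard = #A := Set.ncard_eq_toFinset_card _ _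
  have hpow : (4 / 3 : ℝ) ^ t ≤ 6 * 16 ^ d * Δ := by
    calc (4 / 3 : ℝ) ^ t ≤ (3 / 2) ^ t := pow_le_pow_left₀ (by norm_num) (by norm_num) t
      _ = (3 / 2) ^ s * (3 / 2) := pow_succ _ _
      _ ≤ _ := by linarith
  rw [hA]
  calc #P * V = #P * (V / (2 * Δ)) * (2 * Δ) := by field_simp
    _ ≤ #A * (4 ^ d * (6 * 16 ^ d * Δ)) * (2 * Δ) := by
        have := hdouble.trans (by gcongr : #A * (4 ^ d * (4 / 3 : ℝ) ^ t) ≤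
          #A * (4 ^ d * (6 * 16 ^ d * Δ)))
        gcongr
    _ = _ := by
        rw [show (64 : ℝ) = 4 * 16 by norm_num, mul_pow]; ring

end Dyadic

theorem exists_finite_set_sum_product {K : Type*} [Field K] [NumberField K] [IsTotallyReal K]
    {d : ℕ} (hd : Module.finrank ℚ K = d) (hd2 : 2 ≤ d) {X Y Δ : ℝ} (hX : 2 ≤ X) (hY : 2 ≤ Y)
    (hΔ : Δ = √(|discr K| : ℤ)) :
    ∃ A : Set (𝓞 K), A.Finite ∧
      X ^ d * Y ^ (d - 1) ≤ 512 ^ d * Δ * A.ncard ∧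
      (A.ncard : ℝ) ≤ (8 * X * Y) ^ d ∧
      ((A * A).ncard : ℝ) ≤ 36 ^ d * Y ^ (d - 1) * (X ^ d * Δ) ^ 2 ∧
      ((A + A).ncard : ℝ) ≤ (8 * Real.exp Y) ^ d * Δ * A.ncard := by
  classical
  have hcard : Fintype.card (InfinitePlace K) = d :=
    card_infinitePlace_of_isTotallyReal.trans hd
  have hΔ1 : 1 ≤ Δ := by
    rw [hΔ, Real.one_le_sqrt]
    exact_mod_cast Int.one_le_abs (discr_ne_zero K)
  have hXd : 4 ≤ X ^ d := by
    calc (4 : ℝ) = 2 ^ 2 := by norm_num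
      _ ≤ 2 ^ d := pow_le_pow_right₀ one_le_two hd2
      _ ≤ X ^ d := by gcongr
  set y := ⌊Y⌋₊
  have hyY : (y : ℝ) ≤ Y := Nat.floor_le (by linarith)
  have hYy : Y ≤ 2 * y := by
    have h1 : 2 ≤ y := Nat.le_floor (by exact_mod_cast hY)
    have h2 := Nat.lt_floor_add_one Y
    have h3 : (2 : ℝ) ≤ y := by exact_mod_cast h1
    linarith
  have hy1 : 1 ≤ y := Nat.le_floor (by push_cast; linarith)
  set V := X ^ d * Δ
  have hV4 : 4 * Δ ≤ V := mul_le_mul_of_nonneg_right hXd (by linarith)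
  set H : ℝ := V ^ (d⁻¹ : ℝ) * 2 ^ y
  have hH : 0 < H := by positivity
  have hHd : H ^ d = V * 2 ^ (y * d) := by
    rw [mul_pow, Real.rpow_inv_natCast_pow (by positivity) (by omega), pow_mul]
  have hHV : H ^ d / 2 ^ (y * d) = V := by rw [hHd, mul_div_cancel_right₀ _ (by positivity)]
  set U := dyadicUnion K H (y * d)
  have hUfin : U.Finite := dyadicUnion_finite hH
  have hUX : X ^ d ≤ U.ncard := by
    have h1 := prod_le_ncard_integerBox_mul_sqrt_discr (K := K) (f := fun _ => H / 2 ^ y)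
      fun _ => by positivity
    rw [prod_div_two_pow H fun _ => y, hd, sum_const, card_univ, hcard, smul_eq_mul, mul_comm d, hHV,
      ← hΔ] at h1
    refine (le_of_mul_le_mul_right h1 (by linarith)).trans ?_
    have h2 : dyadicBox K H (fun _ => y) ⊆ U :=
      dyadicBox_subset_dyadicUnion (by simp [hcard, mul_comm])
    exact Nat.cast_le.2 (Set.ncard_le_ncard h2 hUfin)
  have hUY : y ^ (d - 1) * X ^ d ≤ 12 * 64 ^ d * Δ * U.ncard := by
    have h1 := card_mul_le_ncard_dyadicUnion (K := K) (n := y * d) hH hΔ (by rwa [hd, hHV])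
    have h2 := pow_le_card_piAntidiag_univ (ι := InfinitePlace K) y
    rw [hcard] at h2
    have h3 : (y : ℝ) ^ (d - 1) ≤ #(piAntidiag (univ : Finset (InfinitePlace K)) (y * d)) := by
      exact_mod_cast h2
    rw [hd, hHV] at h1
    refine le_of_mul_le_mul_right (a := Δ) ?_ (by linarith)
    calc _ = (y : ℝ) ^ (d - 1) * V := by ring
      _ ≤ #(piAntidiag (univ : Finset (InfinitePlace K)) (y * d)) * V := by gcongr
      _ ≤ _ := h1
      _ = _ := by ring
  have hXY : 1 ≤ (X * Y) ^ d := one_le_pow₀ (by nlinarith)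
  have hfloor : (X * Y) ^ d ≤ ⌊(8 * X * Y) ^ d⌋₊ := by
    have h1 := Nat.lt_floor_add_one ((8 * X * Y) ^ d)
    have h2 : (8 : ℝ) ≤ 8 ^ d := le_self_pow₀ (by norm_num) (by omega)
    rw [mul_assoc 8, mul_pow 8] at h1 ⊢
    nlinarith
  obtain ⟨A, hAU, hA⟩ := Set.exists_subset_card_eq
    (s := U) (n := min U.ncard ⌊(8 * X * Y) ^ d⌋₊) (min_le_left _ _)
  have hle : ∀ {z : ℝ}, z ≤ U.ncard → z ≤ (X * Y) ^ d → z ≤ A.ncard := by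
    intro z h1 h2
    rw [hA, Nat.cast_min]
    exact le_min h1 (h2.trans hfloor)
  have hAX : X ^ d ≤ A.ncard := hle hUX (by gcongr; nlinarith)
  have hAY : y ^ (d - 1) * X ^ d ≤ 12 * 64 ^ d * Δ * A.ncard := by
    rw [mul_assoc (12 * 64 ^ d), mul_comm Δ, ← mul_assoc] at hUY ⊢
    have hpos : 0 < 12 * (64 : ℝ) ^ d * Δ := by positivity
    have : y ^ (d - 1) * X ^ d / (12 * 64 ^ d * Δ) ≤ A.ncard := by
      refine hle ?_ ?_
      · rw [div_le_iff₀ hpos]; linarith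
      · refine (div_le_self (by positivity) ?_).trans ?_
        · have : (1 : ℝ) ≤ 64 ^ d := one_le_pow₀ (by norm_num)
          nlinarith
        · rw [mul_pow, mul_comm]
          gcongr
          calc (y : ℝ) ^ (d - 1) ≤ Y ^ (d - 1) := by gcongr
            _ ≤ Y ^ d := pow_le_pow_right₀ (by linarith) (by omega)
    rw [div_le_iff₀ hpos] at this
    linarith
  refine ⟨A, hUfin.subset hAU, ?_, ?_, ?_, ?_⟩
  · have h12 : (12 : ℝ) ≤ 4 ^ d := by
      calc (12 : ℝ) ≤ 4 ^ 2 := by norm_num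
        _ ≤ 4 ^ d := pow_le_pow_right₀ (by norm_num) hd2
    calc X ^ d * Y ^ (d - 1) ≤ X ^ d * (2 * y) ^ (d - 1) := by gcongr
      _ = 2 ^ (d - 1) * (y ^ (d - 1) * X ^ d) := by rw [mul_pow]; ring
      _ ≤ 2 ^ d * (12 * 64 ^ d * Δ * A.ncard) := by
          gcongr
          · norm_num
          · omega
      _ ≤ 2 ^ d * (4 ^ d * 64 ^ d * Δ * A.ncard) := by gcongr
      _ = 512 ^ d * Δ * A.ncard := by
          rw [show (512 : ℝ) = 2 * 4 * 64 by norm_num, mul_pow, mul_pow]; ring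
  · rw [hA, Nat.cast_min]
    exact (min_le_right _ _).trans (Nat.floor_le (by positivity))
  · have hsub : A * A ⊆ dyadicUnion K (H * H) (y * d + y * d) :=
      (Set.mul_subset_mul hAU hAU).trans dyadicUnion_mul_subset
    have hvol : (H * H) ^ d / 2 ^ (y * d + y * d) = V ^ 2 := by
      rw [mul_pow, pow_add, mul_div_mul_comm, hHV, sq]
    have h1 := ncard_dyadicUnion_le (K := K) (H := H * H) (n := y * d + y * d) (by positivity)
      (by rw [hd, hvol]; nlinarith)
    rw [hd, hvol] at h1
    have h2 := card_piAntidiag_univ_two_mul_le (ι := InfinitePlace K) hy1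
    rw [hcard] at h2
    calc ((A * A).ncard : ℝ) ≤ (dyadicUnion K (H * H) (y * d + y * d)).ncard :=
          mod_cast Set.ncard_le_ncard hsub (dyadicUnion_finite (by positivity))
      _ ≤ _ := h1
      _ ≤ 9 ^ d * Y ^ (d - 1) * (4 ^ d * V ^ 2) := by
          gcongr
          exact h2.trans (by gcongr)
      _ = _ := by rw [show (36 : ℝ) = 9 * 4 by norm_num, mul_pow (9 : ℝ)]; ring
  · have hsub : A + A ⊆ integerBox K fun _ => H + H := by
      rintro _ ⟨a, ha, b, hb, rfl⟩
      exact add_mem_integerBox (dyadicUnion_subset_integerBox hH (hAU ha))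
        (dyadicUnion_subset_integerBox hH (hAU hb))
    have hprod : ∏ _w : InfinitePlace K, (H + H) = 2 ^ d * H ^ d := by
      rw [prod_const, card_univ, hcard, ← two_mul, mul_pow]
    have h1 : 1 ≤ (2 : ℝ) ^ (y * d) := one_le_pow₀ one_le_two
    have h2 : (1 : ℝ) ≤ 2 ^ d := one_le_pow₀ one_le_two
    have hVH : V ≤ H ^ d := by rw [hHd]; nlinarith
    obtain ⟨hfin, hbox⟩ := integerBox_finite_and_ncard_le (K := K) (f := fun _ => H + H)
      (fun _ => by positivity) (by rw [hprod]; nlinarith)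
    rw [hd, hprod] at hbox
    have hexp : (2 : ℝ) ^ y ≤ Real.exp Y := by
      calc (2 : ℝ) ^ y ≤ Real.exp 1 ^ y := by
            gcongr
            linarith [Real.add_one_le_exp 1]
        _ = Real.exp y := by rw [← Real.exp_nat_mul, mul_one]
        _ ≤ Real.exp Y := Real.exp_le_exp.2 hyY
    calc ((A + A).ncard : ℝ) ≤ (integerBox K fun _ => H + H).ncard :=
          mod_cast Set.ncard_le_ncard hsub hfin
      _ ≤ _ := hbox
      _ = 8 ^ d * (2 ^ y) ^ d * Δ * X ^ d := by
          rw [hHd, show (8 : ℝ) = 4 * 2 by norm_num, mul_pow, pow_mul]; ring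
      _ ≤ 8 ^ d * Real.exp Y ^ d * Δ * A.ncard := by gcongr
      _ = _ := by rw [mul_pow]

end NumberField

theorem TotallyReal.isTotallyReal {K : Type*} [Field K] (h : TotallyReal K) :
    NumberField.IsTotallyReal K where
  isReal w := NumberField.InfinitePlace.isReal_iff.2 <|
    NumberField.ComplexEmbedding.isReal_iff.2 <| RingHom.ext fun x =>
      Complex.conj_eq_iff_im.2 (h w.embedding x)

/-- There exists an absolute constant `c > 0` such that for every totally real number
field `K` of degree `d ≥ 2` with (absolute) discriminant `Δ_K`, and all `X, Y ≥ 2`,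
there exists `A ⊆ 𝓞 K` with `(cXY)^d / (Y Δ_K^{3/2}) ≤ |A| ≤ (XY/c)^d`,
`|AA| ≤ c^{-d} Y^{1-d} Δ_K^2 |A|^2` and `|A+A| ≤ (e^Y/c)^d Δ_K^{1/2} |A|`. -/
theorem statement15 :
    ∃ c : ℝ, 0 < c ∧
      ∀ (K : Type) (_ : Field K) (_ : NumberField K), TotallyReal K →
        ∀ d : ℕ, Module.finrank ℚ K = d → 2 ≤ d →
          ∀ X Y : ℝ, 2 ≤ X → 2 ≤ Y →
            ∃ A : Set (𝓞 K), A.Finite ∧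
              (c * X * Y) ^ d /
                  (Y * ((NumberField.discr K).natAbs : ℝ) ^ ((3 : ℝ) / 2)) ≤
                (A.ncard : ℝ) ∧
              (A.ncard : ℝ) ≤ (X * Y / c) ^ d ∧
              ((A * A).ncard : ℝ) ≤
                c ^ (-(d : ℝ)) * Y ^ ((1 : ℝ) - (d : ℝ)) *
                  ((NumberField.discr K).natAbs : ℝ) ^ 2 * (A.ncard : ℝ) ^ 2 ∧
              ((A + A).ncard : ℝ) ≤
                (Real.exp Y / c) ^ d *
                  ((NumberField.discr K).natAbs : ℝ) ^ ((1 : ℝ) / 2) * (A.ncard : ℝ) := by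
  refine ⟨1 / (36 * 512 ^ 2), by positivity, ?_⟩
  intro K _ _ hK d hd hd2 X Y hX hY
  have := hK.isTotallyReal
  set Δ : ℝ := √(|discr K| : ℤ)
  obtain ⟨A, hfin, hlow, hup, hmul, hadd⟩ := exists_finite_set_sum_product hd hd2 hX hY
    (rfl : Δ = _)
  have hΔ1 : 1 ≤ Δ := by
    rw [Real.one_le_sqrt]
    exact_mod_cast Int.one_le_abs (discr_ne_zero K)
  have hdisc : ((discr K).natAbs : ℝ) = Δ ^ 2 := by
    rw [Real.sq_sqrt (by positivity), Nat.cast_natAbs]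
  have hrpow : ∀ k : ℕ, (Δ ^ 2) ^ ((k : ℝ) / 2) = Δ ^ k := by
    intro k
    rw [← Real.rpow_natCast, ← Real.rpow_mul (by linarith), ← Real.rpow_natCast]
    congr 1
    push_cast
    ring
  have h3 : (Δ ^ 2) ^ ((3 : ℝ) / 2) = Δ ^ 3 := mod_cast hrpow 3
  have h1 : (Δ ^ 2) ^ ((1 : ℝ) / 2) = Δ := by simpa using hrpow 1
  have hYpow : Y ^ d = Y ^ (d - 1) * Y := by
    rw [← pow_succ, Nat.sub_add_cancel (by omega)]
  have hYneg : Y ^ ((1 : ℝ) - d) = (Y ^ (d - 1))⁻¹ := by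
    rw [← neg_sub, Real.rpow_neg (by linarith), ← Real.rpow_natCast Y (d - 1),
      Nat.cast_sub (by omega), Nat.cast_one]
  rw [hdisc, h3, h1, hYneg, Real.rpow_neg (by positivity), Real.rpow_natCast, ← inv_pow,
    one_div, inv_inv]
  refine ⟨A, hfin, ?_, ?_, ?_, ?_⟩
  · rw [div_le_iff₀ (by positivity)]
    calc ((36 * 512 ^ 2 : ℝ)⁻¹ * X * Y) ^ d
        = ((36 * 512 ^ 2 : ℝ)⁻¹) ^ d * (X ^ d * Y ^ (d - 1)) * Y := by
          rw [mul_pow, mul_pow, hYpow]; ring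
      _ ≤ ((512 : ℝ)⁻¹) ^ d * (512 ^ d * Δ * A.ncard) * Y := by
          gcongr
          norm_num
      _ = A.ncard * (Y * Δ) := by
          rw [inv_pow]; field_simp
      _ ≤ A.ncard * (Y * Δ ^ 3) := by
          gcongr
          exact le_self_pow₀ hΔ1 (by norm_num)
  · refine hup.trans ?_
    rw [div_inv_eq_mul]
    refine pow_le_pow_left₀ (by positivity) ?_ d
    have : 0 ≤ X * Y := by positivity
    linarith
  · refine hmul.trans ?_
    have hYpos : 0 < Y ^ (d - 1) := by positivity
    calc 36 ^ d * Y ^ (d - 1) * (X ^ d * Δ) ^ 2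
        = 36 ^ d * (Y ^ (d - 1))⁻¹ * Δ ^ 2 * (X ^ d * Y ^ (d - 1)) ^ 2 := by
          field_simp
      _ ≤ 36 ^ d * (Y ^ (d - 1))⁻¹ * Δ ^ 2 * (512 ^ d * Δ * A.ncard) ^ 2 := by gcongr
      _ = _ := by
          rw [mul_pow 36, ← pow_mul 512, mul_comm 2 d, pow_mul]; ring
  · refine hadd.trans ?_
    rw [div_inv_eq_mul, mul_comm (Real.exp Y)]
    gcongr
    norm_num
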